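/- arXiv:1411.7668 — 3 statements merged into one kernel-verified Lean document; each statement's English description precedes it below -/
import Mathlib

section
/- Let X be a geodesic metric space that is δ-hyperbolic in the sense of Gromov, let Y ⊆ X be a nonempty c-quasiconvex subset, let ε ≥ 0, and let x ∈ X. If p and p' are both ε-quasi projections of x onto Y, then d(p, p') ≤ 2c + 4δ + 2ε. -/
/-! Common definitions: geodesic segments, geodesic metric spaces, Gromov hyperbolicity,
almost fixed sets of isometries, quasiconvex hulls, set distance, quasiconvexity. -/

variable {X : Type*}

/-- `γ` is an arclength (isometric) parametrization of a geodesic from `x` to `y`,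
defined on the interval `[0, dist x y]`. -/
def GeodesicParam [MetricSpace X] (γ : ℝ → X) (x y : X) : Prop :=
  γ 0 = x ∧ γ (dist x y) = y ∧
    ∀ s ∈ Set.Icc (0 : ℝ) (dist x y), ∀ t ∈ Set.Icc (0 : ℝ) (dist x y),
      dist (γ s) (γ t) = |s - t|

/-- `s` is a geodesic segment joining `x` to `y`. -/
def IsGeodSegment [MetricSpace X] (s : Set X) (x y : X) : Prop :=
  ∃ γ : ℝ → X, GeodesicParam γ x y ∧ s = γ '' Set.Icc (0 : ℝ) (dist x y)

/-- A geodesic metric space: any two points are joined by a geodesic segment. -/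
def IsGeodesicSpace (X : Type*) [MetricSpace X] : Prop :=
  ∀ x y : X, ∃ s : Set X, IsGeodSegment s x y

/-- The Gromov product `(x, y)_p`. -/
noncomputable def gromovProd [MetricSpace X] (p x y : X) : ℝ :=
  (dist p x + dist p y - dist x y) / 2

/-- `X` is δ-hyperbolic in the sense of Gromov: the Gromov product condition
`(x, y)_p ≥ min ((x, z)_p, (z, y)_p) − δ` holds for all points. -/
def IsGromovHyperbolic (X : Type*) [MetricSpace X] (δ : ℝ) : Prop :=
  ∀ p x y z : X, min (gromovProd p x z) (gromovProd p z y) ≤ gromovProd p x y + δ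

/-- The distance between two subsets of a metric space. -/
noncomputable def setDist [MetricSpace X] (A B : Set X) : ℝ :=
  sInf (Set.image2 dist A B)

/-- The almost fixed set `F_C(φ)` of an isometry `φ`. -/
def almostFixedSet [MetricSpace X] (φ : X ≃ᵢ X) (C : ℝ) : Set X :=
  {x | ∃ n : ℤ, n ≠ 0 ∧ dist x ((φ ^ n) x) ≤ C}

/-- The quasiconvex hull `𝒳_C(φ)`: the union of all geodesic segments joining
pairs of points of the almost fixed set `F_C(φ)`. -/
def qcHull [MetricSpace X] (φ : X ≃ᵢ X) (C : ℝ) : Set X :=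
  {y | ∃ p ∈ almostFixedSet φ C, ∃ q ∈ almostFixedSet φ C,
    ∃ s : Set X, IsGeodSegment s p q ∧ y ∈ s}

/-- `Y` is `c`-quasiconvex: every geodesic segment between points of `Y` lies in the
closed `c`-neighborhood of `Y`. -/
def IsQuasiconvexSet [MetricSpace X] (c : ℝ) (Y : Set X) : Prop :=
  ∀ p ∈ Y, ∀ q ∈ Y, ∀ s : Set X, IsGeodSegment s p q → ∀ y ∈ s, Metric.infDist y Y ≤ c

theorem GeodesicParam.dist_midpoint [MetricSpace X] {γ : ℝ → X} {x y : X}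
    (hγ : GeodesicParam γ x y) :
    dist x (γ (dist x y / 2)) = dist x y / 2 ∧ dist (γ (dist x y / 2)) y = dist x y / 2 := by
  obtain ⟨h0, h1, hd⟩ := hγ
  have hL : 0 ≤ dist x y := dist_nonneg
  have hmid : dist x y / 2 ∈ Set.Icc (0 : ℝ) (dist x y) := ⟨by linarith, by linarith⟩
  have hleft := hd 0 ⟨le_rfl, hL⟩ _ hmid
  have hright := hd _ hmid _ ⟨hL, le_rfl⟩
  rw [h0, zero_sub, abs_neg, abs_of_nonneg hmid.1] at hleft
  rw [h1, abs_of_nonpos (by linarith)] at hright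
  exact ⟨hleft, by linarith⟩

/-- Two points of a quasiconvex set in a geodesic space have a midpoint close to the set. -/
theorem IsQuasiconvexSet.exists_midpoint [MetricSpace X] {c : ℝ} {Y : Set X}
    (hqc : IsQuasiconvexSet c Y) (hgeo : IsGeodesicSpace X) {p q : X} (hp : p ∈ Y) (hq : q ∈ Y) :
    ∃ m : X, Metric.infDist m Y ≤ c ∧ dist p m = dist p q / 2 ∧ dist m q = dist p q / 2 := by
  obtain ⟨s, γ, hγ, rfl⟩ := hgeo p q
  have hL : 0 ≤ dist p q := dist_nonneg
  exact ⟨γ (dist p q / 2), hqc p hp q hq _ ⟨γ, hγ, rfl⟩ _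
    (Set.mem_image_of_mem γ ⟨by linarith, by linarith⟩), hγ.dist_midpoint⟩

/-- quasi-uniqueness of ε-quasi projections onto a c-quasiconvex subset
of a δ-hyperbolic geodesic metric space. -/
theorem quasiProjection_quasiUnique (X : Type*) [MetricSpace X] (δ c ε : ℝ)
    (hδ : 0 ≤ δ) (hε : 0 ≤ ε)
    (hgeo : IsGeodesicSpace X) (hhyp : IsGromovHyperbolic X δ)
    (Y : Set X) (hY : Y.Nonempty) (hqc : IsQuasiconvexSet c Y)
    (x p p' : X)
    (hp : p ∈ Y) (hpd : dist x p ≤ Metric.infDist x Y + ε)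
    (hp' : p' ∈ Y) (hpd' : dist x p' ≤ Metric.infDist x Y + ε) :
    dist p p' ≤ 2 * c + 4 * δ + 2 * ε := by
  obtain ⟨m, hm, hpm, hmp'⟩ := hqc.exists_midpoint hgeo hp hp'
  have hx : Metric.infDist x Y ≤ Metric.infDist m Y + dist x m := Metric.infDist_le_infDist_add_dist
  have h := hhyp m p p' x
  simp only [gromovProd] at h
  rw [dist_comm p m] at hpm
  rw [dist_comm p x, dist_comm m x] at h
  rcases min_le_iff.mp h with h | h <;> linarith
end

section
/- Let X be a geodesic metric space that is δ-hyperbolic in the sense of Gromov and let [x_p, x_q] be a geodesic segment in X. Let p, q ∈ X be points such that x_p is a closest-point projection of p onto the segment [x_p, x_q] (i.e. d(p, x_p) = d(p, [x_p, x_q])) and x_q is a closest-point projection of q onto [x_p, x_q]. If d(x_p, x_q) > 100δ, then the concatenated path [p, x_p] ∪ [x_p, x_q] ∪ [x_q, q], formed by geodesic segments and parametrized by arclength, is a (1, 30δ)-quasigeodesic. -/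
/-! Common definitions: geodesic segments, geodesic metric spaces, Gromov hyperbolicity,
almost fixed sets of isometries, quasiconvex hulls, set distance, quasiconvexity. -/

variable {X : Type*}

/-- If `c 0` is a point of a geodesic `c` closest to `a`, then the Gromov product of `a` and
`c T` based at `c 0` is at most `2δ`. -/
theorem IsGromovHyperbolic.dist_add_le_of_closest {X : Type*} [MetricSpace X] {δ : ℝ}
    (hhyp : IsGromovHyperbolic X δ) {a : X} {c : ℝ → X} {T : ℝ} (hT : 0 ≤ T)
    (hc : ∀ s ∈ Set.Icc (0 : ℝ) T, ∀ t ∈ Set.Icc (0 : ℝ) T, dist (c s) (c t) = |s - t|)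
    (hmin : ∀ s ∈ Set.Icc (0 : ℝ) T, dist a (c 0) ≤ dist a (c s)) :
    dist a (c 0) + T ≤ dist a (c T) + 4 * δ := by
  have h0 : (0 : ℝ) ∈ Set.Icc (0 : ℝ) T := ⟨le_rfl, hT⟩
  have hTT : T ∈ Set.Icc (0 : ℝ) T := ⟨hT, le_rfl⟩
  have hxT : dist (c 0) (c T) = T := by
    rw [hc 0 h0 T hTT, zero_sub, abs_neg, abs_of_nonneg hT]
  obtain ⟨g, hg⟩ : ∃ g, g = (dist a (c 0) + T - dist a (c T)) / 2 := ⟨_, rfl⟩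
  have hgI : g ∈ Set.Icc (0 : ℝ) T := by
    have t₁ := dist_triangle a (c 0) (c T)
    have t₂ := dist_triangle_right a (c 0) (c T)
    have t₃ := dist_triangle a (c T) (c 0)
    rw [dist_comm (c T)] at t₃
    constructor <;> linarith
  have hxm : dist (c 0) (c g) = g := by
    rw [hc 0 h0 g hgI, zero_sub, abs_neg, abs_of_nonneg hgI.1]
  have hmT : dist (c T) (c g) = T - g := by
    rw [hc T hTT g hgI, abs_of_nonneg (sub_nonneg.2 hgI.2)]
  have hm := hmin g hgI
  have key := hhyp (c 0) a (c g) (c T)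
  unfold gromovProd at key
  rw [hxT, hxm, hmT, dist_comm (c 0) a] at key
  rcases min_le_iff.1 key with h | h <;> linarith

/-- A point of a geodesic from `p` to a closest point `x` of `S` has `x` as a closest point. -/
theorem dist_le_dist_of_closest {X : Type*} [MetricSpace X] {p x a z : X} {S : Set X}
    (hp : dist p x = Metric.infDist p S) (ha : dist p a + dist a x = dist p x) (hz : z ∈ S) :
    dist a x ≤ dist a z := by
  have h₁ := Metric.infDist_le_dist_of_mem (x := p) hz
  have h₂ := dist_triangle p a z
  linarith

/-- In a hyperbolic space, broken geodesics `a, x, y, b` with small Gromov products at the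
corners and long middle piece are almost geodesic. -/
theorem IsGromovHyperbolic.dist_add_dist_add_dist_le {X : Type*} [MetricSpace X] {δ : ℝ}
    (hhyp : IsGromovHyperbolic X δ) {a x y b : X}
    (hx : dist a x + dist x y ≤ dist a y + 4 * δ) (hy : dist b y + dist x y ≤ dist b x + 4 * δ)
    (hxy : 5 * δ < dist x y) :
    dist a x + dist x y + dist b y ≤ dist a b + 10 * δ := by
  have key := hhyp x a y b
  unfold gromovProd at key
  rw [dist_comm x a, dist_comm x b] at key
  rcases min_le_iff.1 key with h | h <;> linarith

/-- Kapovich–Weidmann, Lemma 3.12: if `x_p` is a closest-point projection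
of `p` onto a geodesic segment `[x_p, x_q]`, `x_q` is a closest-point projection of `q`
onto it, and `dist x_p x_q > 100δ`, then the arclength-parametrized concatenation
`[p, x_p] ∪ [x_p, x_q] ∪ [x_q, q]` is a `(1, 30δ)`-quasigeodesic. -/
theorem concatenation_is_quasigeodesic (X : Type*) [MetricSpace X] (δ : ℝ)
    (hδ : 0 ≤ δ) (hgeo : IsGeodesicSpace X) (hhyp : IsGromovHyperbolic X δ)
    (p q xp xq : X) (γ₁ γ₂ γ₃ : ℝ → X)
    (h₁ : GeodesicParam γ₁ p xp) (h₂ : GeodesicParam γ₂ xp xq)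
    (h₃ : GeodesicParam γ₃ xq q)
    (hprojp : dist p xp = Metric.infDist p (γ₂ '' Set.Icc (0 : ℝ) (dist xp xq)))
    (hprojq : dist q xq = Metric.infDist q (γ₂ '' Set.Icc (0 : ℝ) (dist xp xq)))
    (hfar : 100 * δ < dist xp xq)
    (σ : ℝ → X)
    (hσ : ∀ t : ℝ, σ t =
      if t ≤ dist p xp then γ₁ t
      else if t ≤ dist p xp + dist xp xq then γ₂ (t - dist p xp)
      else γ₃ (t - (dist p xp + dist xp xq))) :
    ∀ s₁ ∈ Set.Icc (0 : ℝ) (dist p xp + dist xp xq + dist xq q),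
      ∀ s₂ ∈ Set.Icc (0 : ℝ) (dist p xp + dist xp xq + dist xq q),
        |s₁ - s₂| ≤ 1 * dist (σ s₁) (σ s₂) + 30 * δ := by
  have hL : 0 ≤ dist xp xq := dist_nonneg
  have hP : 0 ≤ dist p xp := dist_nonneg
  have hQ : 0 ≤ dist xq q := dist_nonneg
  obtain ⟨h₁0, h₁1, h₁d⟩ := h₁
  obtain ⟨h₂0, h₂1, h₂d⟩ := h₂
  obtain ⟨h₃0, h₃1, h₃d⟩ := h₃
  have minp : ∀ s ∈ Set.Icc 0 (dist p xp), ∀ t ∈ Set.Icc 0 (dist xp xq),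
      dist (γ₁ s) xp ≤ dist (γ₁ s) (γ₂ t) := fun s hs t ht => by
    refine dist_le_dist_of_closest hprojp ?_ (Set.mem_image_of_mem γ₂ ht)
    have e₁ := h₁d 0 ⟨le_rfl, hP⟩ s hs
    have e₂ := h₁d s hs _ ⟨hP, le_rfl⟩
    rw [h₁0, zero_sub, abs_neg, abs_of_nonneg hs.1] at e₁
    rw [h₁1, abs_sub_comm, abs_of_nonneg (sub_nonneg.2 hs.2)] at e₂
    linarith
  have minq : ∀ s ∈ Set.Icc 0 (dist xq q), ∀ t ∈ Set.Icc 0 (dist xp xq),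
      dist (γ₃ s) xq ≤ dist (γ₃ s) (γ₂ t) := fun s hs t ht => by
    refine dist_le_dist_of_closest hprojq ?_ (Set.mem_image_of_mem γ₂ ht)
    have e₁ := h₃d s hs 0 ⟨le_rfl, hQ⟩
    have e₂ := h₃d _ ⟨hQ, le_rfl⟩ s hs
    rw [h₃0, sub_zero, abs_of_nonneg hs.1] at e₁
    rw [h₃1, abs_of_nonneg (sub_nonneg.2 hs.2)] at e₂
    rw [dist_comm q xq]
    linarith
  have cornerp : ∀ s ∈ Set.Icc 0 (dist p xp), ∀ t ∈ Set.Icc 0 (dist xp xq),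
      dist (γ₁ s) xp + t ≤ dist (γ₁ s) (γ₂ t) + 4 * δ := fun s hs t ht => by
    have sub : ∀ u ∈ Set.Icc 0 t, u ∈ Set.Icc 0 (dist xp xq) :=
      fun u hu => ⟨hu.1, hu.2.trans ht.2⟩
    have := hhyp.dist_add_le_of_closest (a := γ₁ s) (c := γ₂) ht.1
      (fun u hu v hv => h₂d u (sub u hu) v (sub v hv))
      (fun u hu => by rw [h₂0]; exact minp s hs u (sub u hu))
    rwa [h₂0] at this
  have cornerq : ∀ s ∈ Set.Icc 0 (dist xq q), ∀ t ∈ Set.Icc 0 (dist xp xq),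
      dist (γ₃ s) xq + (dist xp xq - t) ≤ dist (γ₃ s) (γ₂ t) + 4 * δ := fun s hs t ht => by
    have sub : ∀ u ∈ Set.Icc 0 (dist xp xq - t), dist xp xq - u ∈ Set.Icc 0 (dist xp xq) :=
      fun u hu => ⟨by linarith [hu.2, ht.1], by linarith [hu.1]⟩
    have := hhyp.dist_add_le_of_closest (a := γ₃ s) (c := fun u => γ₂ (dist xp xq - u))
      (sub_nonneg.2 ht.2)
      (fun u hu v hv => by
        rw [h₂d _ (sub u hu) _ (sub v hv), sub_sub_sub_cancel_left, abs_sub_comm])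
      (fun u hu => by simpa [h₂1] using minq s hs _ (sub u hu))
    simpa [h₂1] using this
  have d₁ : ∀ s ∈ Set.Icc 0 (dist p xp), dist (γ₁ s) xp = dist p xp - s := fun s hs => by
    have e := h₁d s hs _ ⟨hP, le_rfl⟩
    rwa [h₁1, abs_sub_comm, abs_of_nonneg (sub_nonneg.2 hs.2)] at e
  have d₃ : ∀ s ∈ Set.Icc 0 (dist xq q), dist (γ₃ s) xq = s := fun s hs => by
    have e := h₃d s hs 0 ⟨le_rfl, hQ⟩
    rwa [h₃0, sub_zero, abs_of_nonneg hs.1] at e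
  intro s₁ hs₁ s₂ hs₂
  wlog hle : s₁ ≤ s₂ generalizing s₁ s₂
  · rw [abs_sub_comm, dist_comm]
    exact this s₂ hs₂ s₁ hs₁ (le_of_not_ge hle)
  rw [one_mul, hσ s₁, hσ s₂, abs_sub_comm, abs_of_nonneg (sub_nonneg.2 hle)]
  obtain ⟨a₁, b₁⟩ := hs₁
  obtain ⟨a₂, b₂⟩ := hs₂
  split_ifs with c₁ c₂ <;> try (exfalso; linarith)
  · rw [h₁d s₁ ⟨a₁, c₁⟩ s₂ ⟨a₂, c₂⟩]
    linarith [neg_le_abs (s₁ - s₂)]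
  · have := cornerp s₁ ⟨a₁, c₁⟩ (s₂ - dist p xp) ⟨by linarith, by linarith⟩
    linarith [d₁ s₁ ⟨a₁, c₁⟩]
  · have m₃ : s₂ - (dist p xp + dist xp xq) ∈ Set.Icc 0 (dist xq q) :=
      ⟨by linarith, by linarith⟩
    have k₁ := cornerp s₁ ⟨a₁, c₁⟩ _ ⟨hL, le_rfl⟩
    have k₂ := cornerq _ m₃ 0 ⟨le_rfl, hL⟩
    rw [h₂1] at k₁
    rw [h₂0, sub_zero] at k₂
    have := hhyp.dist_add_dist_add_dist_le k₁ k₂ (by linarith)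
    linarith [d₁ s₁ ⟨a₁, c₁⟩, d₃ _ m₃]
  · rw [h₂d _ ⟨by linarith, by linarith⟩ _ ⟨by linarith, by linarith⟩]
    linarith [neg_le_abs (s₁ - dist p xp - (s₂ - dist p xp))]
  · have m₃ : s₂ - (dist p xp + dist xp xq) ∈ Set.Icc 0 (dist xq q) :=
      ⟨by linarith, by linarith⟩
    have := cornerq _ m₃ (s₁ - dist p xp) ⟨by linarith, by linarith⟩
    rw [dist_comm (γ₃ _) (γ₂ _)] at this
    linarith [d₃ _ m₃]
  · rw [h₃d _ ⟨by linarith, by linarith⟩ _ ⟨by linarith, by linarith⟩]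
    linarith [neg_le_abs (s₁ - (dist p xp + dist xp xq) - (s₂ - (dist p xp + dist xp xq)))]
end

section
/- Let X be a geodesic metric space, let C > 0, and let φ₁ and φ₂ be isometries of X with nonempty almost fixed sets. Suppose the distance between the quasiconvex hulls 𝒳_C(φ₁) and 𝒳_C(φ₂) is strictly positive and is realized by points p₁ ∈ 𝒳_C(φ₁) and p₂ ∈ 𝒳_C(φ₂), i.e. d(p₁, p₂) = d(𝒳_C(φ₁), 𝒳_C(φ₂)) > 0. Then for every integer n ≠ 0 one has d(p₁, φ₁ⁿ p₁) ≥ C. -/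
/-! Common definitions: geodesic segments, geodesic metric spaces, Gromov hyperbolicity,
almost fixed sets of isometries, quasiconvex hulls, set distance, quasiconvexity. -/

variable {X : Type*}

theorem almostFixedSet_subset_qcHull [MetricSpace X] (φ : X ≃ᵢ X) (C : ℝ) :
    almostFixedSet φ C ⊆ qcHull φ C := by
  intro x hx
  refine ⟨x, hx, x, hx, _, ⟨fun _ => x, ⟨rfl, rfl, ?_⟩, rfl⟩, 0, by simp, rfl⟩
  intro s hs t ht
  rw [dist_self, Set.Icc_self, Set.mem_singleton_iff] at hs ht
  simp [hs, ht]

theorem setDist_le_dist [MetricSpace X] {A B : Set X} {a b : X} (ha : a ∈ A) (hb : b ∈ B) :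
    setDist A B ≤ dist a b :=
  csInf_le ⟨0, by rintro _ ⟨x, _, y, _, rfl⟩; exact dist_nonneg⟩ (Set.mem_image2_of_mem ha hb)

/-- if `p₁ ∈ 𝒳_C(φ₁)` and `p₂ ∈ 𝒳_C(φ₂)` realize the (positive) distance
between the two quasiconvex hulls, then `dist p₁ (φ₁ⁿ p₁) ≥ C` for every `n ≠ 0`. -/
theorem dist_to_twisted_point_ge (X : Type*) [MetricSpace X]
    (hgeo : IsGeodesicSpace X) (C : ℝ) (hC : 0 < C) (φ₁ φ₂ : X ≃ᵢ X)
    (h₁ : (almostFixedSet φ₁ C).Nonempty) (h₂ : (almostFixedSet φ₂ C).Nonempty)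
    (p₁ p₂ : X) (hp₁ : p₁ ∈ qcHull φ₁ C) (hp₂ : p₂ ∈ qcHull φ₂ C)
    (hreal : dist p₁ p₂ = setDist (qcHull φ₁ C) (qcHull φ₂ C))
    (hpos : 0 < setDist (qcHull φ₁ C) (qcHull φ₂ C)) :
    ∀ n : ℤ, n ≠ 0 → C ≤ dist p₁ ((φ₁ ^ n) p₁) := by
  intro n hn
  by_contra! hlt
  obtain ⟨_, γ, ⟨hγ₀, hγ₁, hγ⟩, -⟩ := hgeo p₁ p₂
  have hd : 0 < dist p₁ p₂ := hreal ▸ hpos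
  obtain ⟨t, ht, htd, htC⟩ : ∃ t : ℝ, 0 < t ∧ t ≤ dist p₁ p₂ ∧
      2 * t ≤ C - dist p₁ ((φ₁ ^ n) p₁) :=
    ⟨min (dist p₁ p₂) ((C - dist p₁ ((φ₁ ^ n) p₁)) / 2), lt_min hd (by linarith),
      min_le_left _ _, by
        linarith [min_le_right (dist p₁ p₂) ((C - dist p₁ ((φ₁ ^ n) p₁)) / 2)]⟩
  have hstart : dist (γ t) p₁ = t := by
    rw [← hγ₀, hγ t ⟨ht.le, htd⟩ 0 ⟨le_rfl, hd.le⟩, sub_zero, abs_of_pos ht]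
  have hend : dist (γ t) p₂ = dist p₁ p₂ - t := by
    conv_lhs => rw [← hγ₁]
    rw [hγ t ⟨ht.le, htd⟩ _ ⟨hd.le, le_rfl⟩, abs_sub_comm, abs_of_nonneg (by linarith)]
  have hfixed : γ t ∈ almostFixedSet φ₁ C := by
    refine ⟨n, hn, ?_⟩
    have htri := dist_triangle4 (γ t) p₁ ((φ₁ ^ n) p₁) ((φ₁ ^ n) (γ t))
    rw [(φ₁ ^ n).dist_eq, dist_comm p₁ (γ t), hstart] at htri
    linarith
  have hle := setDist_le_dist (almostFixedSet_subset_qcHull φ₁ C hfixed) hp₂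
  linarith
end
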